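/- arXiv:1402.1002 — 2 statements merged into one kernel-verified Lean document; each statement's English description precedes it below -/
import Mathlib

section
/- Let p be an odd prime and G a group of order p⁵ having a subgroup of order p not contained in the center Z(G), whose Frattini subgroup Φ(G) has order p. Then the transiso graph Γ_p(G) is not complete, i.e., there exist two distinct subgroups of G of order p that admit no pair of isomorphic NRTs. -/
/-- `S` is a normalized right transversal (NRT) of `H` in `G`: `1 ∈ S` and every `g ∈ G`
is uniquely `h * s` with `h ∈ H`, `s ∈ S`. -/
def IsNRT {G : Type*} [Group G] (H : Subgroup G) (S : Set G) : Prop :=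
  (1 : G) ∈ S ∧ ∀ g : G, ∃! s, s ∈ S ∧ ∃ h ∈ H, g = h * s

/-- `φ` is an isomorphism of NRTs from `S₁` (an NRT of `H₁`) onto `S₂` (an NRT of `H₂`):
it is a bijection from `S₁` to `S₂` carrying the induced operation of `S₁` to that of `S₂`,
where `z = x ∘ y` in `S` means `z ∈ S` and `x * y ∈ H * z`. -/
def IsNRTIso {G : Type*} [Group G] (H₁ H₂ : Subgroup G) (S₁ S₂ : Set G) (φ : G → G) : Prop :=
  Set.BijOn φ S₁ S₂ ∧
    ∀ x ∈ S₁, ∀ y ∈ S₁, ∀ z ∈ S₁, (∃ h ∈ H₁, x * y = h * z) →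
      ∃ h ∈ H₂, φ x * φ y = h * φ z

/-- Two subgroups are adjacent in the transiso graph if they admit isomorphic NRTs. -/
def TransisoAdj {G : Type*} [Group G] (H₁ H₂ : Subgroup G) : Prop :=
  ∃ S₁ S₂ : Set G, IsNRT H₁ S₁ ∧ IsNRT H₂ S₂ ∧ ∃ φ : G → G, IsNRTIso H₁ H₂ S₁ S₂ φ

/-- The transiso graph `Γ_d(G)` is complete: any two distinct subgroups of order `d`
are adjacent. -/
def TransisoComplete (G : Type*) [Group G] (d : ℕ) : Prop :=
  ∀ H₁ H₂ : Subgroup G, Nat.card H₁ = d → Nat.card H₂ = d → H₁ ≠ H₂ →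
    TransisoAdj H₁ H₂

open Subgroup

section PrimeOrder

variable {G : Type*} [Group G] {p : ℕ}

theorem Subgroup.zpowers_eq_of_card_prime (hp : p.Prime) {A : Subgroup G} (hA : Nat.card A = p)
    {g : G} (hg : g ∈ A) (h1 : g ≠ 1) : zpowers g = A := by
  have : Finite A := Nat.finite_of_card_ne_zero (hA ▸ hp.ne_zero)
  have hle : zpowers g ≤ A := zpowers_le.mpr hg
  refine eq_of_le_of_card_ge hle ?_
  have hdvd : Nat.card (zpowers g) ∣ p := hA ▸ card_dvd_of_le hle
  rcases (Nat.dvd_prime hp).mp hdvd with h | h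
  · rw [Nat.card_zpowers, orderOf_eq_one_iff] at h
    exact absurd h h1
  · rw [h, hA]

theorem Subgroup.eq_of_card_prime_of_mem (hp : p.Prime) {A B : Subgroup G} (hA : Nat.card A = p)
    (hB : Nat.card B = p) {g : G} (hgA : g ∈ A) (hgB : g ∈ B) (h1 : g ≠ 1) : A = B :=
  (zpowers_eq_of_card_prime hp hA hgA h1).symm.trans (zpowers_eq_of_card_prime hp hB hgB h1)

theorem IsPGroup.normal_le_center_of_card_prime [Fact p.Prime] [Finite G] (hG : IsPGroup p G)
    {N : Subgroup G} [N.Normal] (hN : Nat.card N = p) : N ≤ center G := by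
  have hC : IsPGroup p (ConjAct G) := hG
  obtain ⟨b, hb, hb1⟩ := hC.exists_fixed_point_of_prime_dvd_card_of_fixed_point N
    (dvd_of_eq hN.symm) (a := 1) (fun g => smul_one g)
  rw [← zpowers_eq_of_card_prime Fact.out hN b.2 (fun h => hb1 (Subtype.ext h.symm)), zpowers_le,
    mem_center_iff]
  intro g
  have := congrArg Subtype.val (hb (ConjAct.toConjAct g))
  rw [ConjAct.Subgroup.val_conj_smul, ConjAct.toConjAct_smul] at this
  exact mul_inv_eq_iff_eq_mul.mp this

theorem IsPGroup.index_of_isCoatom [Fact p.Prime] [Finite G] (hG : IsPGroup p G)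
    {M : Subgroup G} (hM : IsCoatom M) : M.index = p := by
  obtain ⟨m, hm⟩ := IsPGroup.iff_card.mp (hG.to_subgroup M)
  obtain ⟨i, hi⟩ := hG.index M
  have hi0 : i ≠ 0 := by
    rintro rfl
    exact hM.1 (index_eq_one.mp (by simpa using hi))
  have hcard : Nat.card M * M.index = Nat.card G := M.card_mul_index
  have hdvd : p ^ (m + 1) ∣ Nat.card G := by
    rw [← hcard, hm, hi, ← pow_add]
    exact pow_dvd_pow _ (by omega)
  obtain ⟨K, hK, hMK⟩ := Sylow.exists_subgroup_card_pow_succ hdvd hm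
  have hKtop : K = ⊤ := by
    refine hM.2 K (lt_of_le_of_ne hMK ?_)
    rintro rfl
    rw [hm] at hK
    exact absurd (Nat.pow_right_injective (Fact.out : p.Prime).two_le hK) (by omega)
  rw [hKtop, card_top, ← hcard, hm, pow_succ] at hK
  exact Nat.eq_of_mul_eq_mul_left (pow_pos (Fact.out : p.Prime).pos _) hK

theorem IsPGroup.normal_of_isCoatom [Fact p.Prime] [Finite G] (hG : IsPGroup p G)
    {M : Subgroup G} (hM : IsCoatom M) : M.Normal :=
  have := hG.isNilpotent
  NormalizerCondition.normal_of_coatom M Group.normalizerCondition_of_isNilpotent hM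

theorem IsPGroup.pow_mem_frattini [Fact p.Prime] [Finite G] (hG : IsPGroup p G) (g : G) :
    g ^ p ∈ frattini G := by
  simp only [frattini, Order.radical, mem_iInf]
  intro M hM
  have := hG.normal_of_isCoatom hM
  rw [← hG.index_of_isCoatom hM]
  exact M.pow_index_mem g

theorem IsPGroup.commutator_mem_frattini [Fact p.Prime] [Finite G] (hG : IsPGroup p G) (g h : G) :
    g * h * g⁻¹ * h⁻¹ ∈ frattini G := by
  simp only [frattini, Order.radical, mem_iInf]
  intro M hM
  have := hG.normal_of_isCoatom hM
  have hc : Nat.card (G ⧸ M) = p := hG.index_of_isCoatom hM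
  have := isCyclic_of_prime_card hc
  rw [← QuotientGroup.eq_one_iff]
  rw [QuotientGroup.mk_mul, QuotientGroup.mk_mul, QuotientGroup.mk_mul, QuotientGroup.mk_inv,
    QuotientGroup.mk_inv, mul_assoc, ← mul_inv_rev, mul_inv_eq_one]
  exact IsCyclic.commGroup.mul_comm _ _

end PrimeOrder

section Transversal

variable {G : Type*} [Group G] {F H : Subgroup G} {S T : Set G} {φ : G → G}

theorem IsNRT.exists_mul (hS : IsNRT H S) (g : G) : ∃ h ∈ H, ∃ s ∈ S, g = h * s := by
  obtain ⟨s, ⟨hs, h, hh, e⟩, -⟩ := hS.2 g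
  exact ⟨h, hh, s, hs, e⟩

theorem IsNRT.eq_of_mul (hS : IsNRT H S) {h s t : G} (hh : h ∈ H) (hs : s ∈ S) (ht : t ∈ S)
    (e : s = h * t) : s = t :=
  (hS.2 s).unique ⟨hs, 1, H.one_mem, (one_mul s).symm⟩ ⟨ht, h, hh, e⟩

/-- If the operation of `S` is commutative then so is that of an isomorphic `T`. -/
theorem IsNRTIso.comm (hS : IsNRT F S) (hφ : IsNRTIso F H S T φ)
    (hF : ∀ x y : G, x * y * x⁻¹ * y⁻¹ ∈ F) {x y : G} (hx : x ∈ T) (hy : y ∈ T) :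
    ∃ h ∈ H, x * y = h * (y * x) := by
  obtain ⟨a, ha, rfl⟩ := hφ.1.surjOn hx
  obtain ⟨b, hb, rfl⟩ := hφ.1.surjOn hy
  obtain ⟨f, hf, c, hc, e⟩ := hS.exists_mul (b * a)
  obtain ⟨h₁, hh₁, e₁⟩ := hφ.2 b hb a ha c hc ⟨f, hf, e⟩
  obtain ⟨h₂, hh₂, e₂⟩ := hφ.2 a ha b hb c hc
    ⟨a * b * a⁻¹ * b⁻¹ * f, F.mul_mem (hF a b) hf, by
      rw [mul_assoc _ f, ← e]; group⟩
  exact ⟨h₂ * h₁⁻¹, H.mul_mem hh₂ (H.inv_mem hh₁), by rw [e₁, e₂]; group⟩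

/-- A transversal isomorphic to one of a normal subgroup is closed under multiplication
up to the normal core. -/
theorem IsNRTIso.exists_mem_normalCore [hFn : F.Normal] (hS : IsNRT F S) (hT : IsNRT H T)
    (hφ : IsNRTIso F H S T φ) {y z : G} (hy : y ∈ T) (hz : z ∈ T) :
    ∃ h ∈ H.normalCore, ∃ b ∈ T, y * z = h * b := by
  obtain ⟨y, hyS, rfl⟩ := hφ.1.surjOn hy
  obtain ⟨z, hzS, rfl⟩ := hφ.1.surjOn hz
  obtain ⟨f', hf', b, hb, e'⟩ := hS.exists_mul (y * z)
  obtain ⟨h₂, hh₂, e₂⟩ := hφ.2 y hyS z hzS b hb ⟨f', hf', e'⟩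
  have key : ∀ x ∈ S, φ x * h₂ * (φ x)⁻¹ ∈ H := by
    intro x hx
    obtain ⟨f, hf, a, ha, e⟩ := hS.exists_mul (x * y)
    obtain ⟨f'', hf'', w, hw, e''⟩ := hS.exists_mul (a * z)
    obtain ⟨h₁, hh₁, e₁⟩ := hφ.2 x hx y hyS a ha ⟨f, hf, e⟩
    obtain ⟨h₃, hh₃, e₃⟩ := hφ.2 a ha z hzS w hw ⟨f'', hf'', e''⟩
    obtain ⟨h₄, hh₄, e₄⟩ := hφ.2 x hx b hb w hw
      ⟨x * f'⁻¹ * x⁻¹ * f * f'', F.mul_mem (F.mul_mem (hFn.conj_mem _ (F.inv_mem hf') x) hf) hf'', by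
        have hb' : b = f'⁻¹ * (y * z) := by rw [e']; group
        calc x * b = x * f'⁻¹ * x⁻¹ * (x * y) * z := by rw [hb']; group
          _ = x * f'⁻¹ * x⁻¹ * f * (a * z) := by rw [e]; group
          _ = _ := by rw [e'']; group⟩
    have : φ x * h₂ * (φ x)⁻¹ = h₁ * h₃ * h₄⁻¹ := by
      have l : φ x * φ y * φ z = h₁ * h₃ * φ w := by rw [e₁, mul_assoc, e₃, mul_assoc]
      have r : φ x * φ y * φ z = φ x * h₂ * (φ x)⁻¹ * h₄ * φ w := by
        rw [mul_assoc, e₂, mul_assoc _ h₄, ← e₄]; group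
      rw [l] at r
      rw [eq_mul_inv_iff_mul_eq]
      exact (mul_right_cancel r).symm
    rw [this]
    exact H.mul_mem (H.mul_mem hh₁ hh₃) (H.inv_mem hh₄)
  refine ⟨h₂, fun g => ?_, φ b, hφ.1.mapsTo hb, e₂⟩
  obtain ⟨k, hk, s, hs, rfl⟩ := hT.exists_mul g
  obtain ⟨x, hx, rfl⟩ := hφ.1.surjOn hs
  have := H.mul_mem (H.mul_mem hk (key x hx)) (H.inv_mem hk)
  simpa [mul_assoc] using this

/-- A transversal isomorphic to one of a normal subgroup with abelian quotient, for a core-free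
subgroup, is an abelian complement. -/
theorem IsNRTIso.exists_comm_complement [F.Normal] [Finite G] (hS : IsNRT F S) (hT : IsNRT H T)
    (hφ : IsNRTIso F H S T φ) (hF : ∀ x y : G, x * y * x⁻¹ * y⁻¹ ∈ F) (hH : H.normalCore = ⊥) :
    ∃ K : Subgroup G, IsComplement (H : Set G) K ∧ ∀ x ∈ K, ∀ y ∈ K, x * y = y * x := by
  have hmul : ∀ {y z : G}, y ∈ T → z ∈ T → y * z ∈ T := by
    intro y z hy hz
    obtain ⟨h, hh, b, hb, e⟩ := hφ.exists_mem_normalCore hS hT hy hz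
    rw [hH, mem_bot] at hh
    rwa [e, hh, one_mul]
  let M : Submonoid G := { carrier := T, mul_mem' := hmul, one_mem' := hT.1 }
  let K : Subgroup G :=
    { M with
      inv_mem' := fun {x} hx => by
        obtain ⟨n, hn : x ^ n = x⁻¹⟩ := (isOfFinOrder_of_finite x).mem_powers_iff_mem_zpowers.mpr
          (inv_mem (mem_zpowers x))
        exact hn ▸ M.pow_mem hx n }
  refine ⟨K, isComplement_iff_existsUnique.mpr fun g => ?_, fun x hx y hy => ?_⟩
  · obtain ⟨h, hh, s, hs, rfl⟩ := hT.exists_mul g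
    refine ⟨(⟨h, hh⟩, ⟨s, hs⟩), rfl, ?_⟩
    rintro ⟨⟨h', hh'⟩, ⟨s', hs'⟩⟩ (e : h' * s' = h * s)
    have hss : s' = s := hT.eq_of_mul (H.mul_mem (H.inv_mem hh') hh) hs' hs (by
      rw [mul_assoc, ← e]; group)
    subst hss
    obtain rfl := mul_right_cancel e
    rfl
  · obtain ⟨h, hh, e⟩ := hφ.comm hS hF hx hy
    exact hT.eq_of_mul hh (hmul hx hy) (hmul hy hx) e

end Transversal

/-- The homomorphism `k ↦ ([k, h], k ^ n)` on an abelian subgroup. -/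
def commutatorPowHom {G : Type*} [Group G] {F K : Subgroup G} (hFc : F ≤ center G) (n : ℕ) (h : G)
    (hcomm : ∀ x y : G, x * y * x⁻¹ * y⁻¹ ∈ F) (hpow : ∀ x : G, x ^ n ∈ F)
    (hK : ∀ x ∈ K, ∀ y ∈ K, x * y = y * x) : K →* F × F :=
  MonoidHom.mk' (fun k => (⟨k * h * (k : G)⁻¹ * h⁻¹, hcomm k h⟩, ⟨(k : G) ^ n, hpow k⟩)) <| by
    intro a b
    refine Prod.ext (Subtype.ext ?_) (Subtype.ext ?_)
    · have hc := mem_center_iff.mp (hFc (hcomm b h)) a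
      have : (a * b : G) * h * (a * b : G)⁻¹ * h⁻¹
          = a * (b * h * (b : G)⁻¹ * h⁻¹) * (h * (a : G)⁻¹ * h⁻¹) := by group
      have hc' := mem_center_iff.mp (hFc (hcomm b h)) (a * h * (a : G)⁻¹ * h⁻¹)
      change (a * b : G) * h * (a * b : G)⁻¹ * h⁻¹
        = (a * h * (a : G)⁻¹ * h⁻¹) * (b * h * (b : G)⁻¹ * h⁻¹)
      rw [this, hc, hc']
      group
    · exact (show Commute (a : G) b from hK a a.2 b b.2).mul_pow n

theorem stmt_17 {G : Type*} [Group G] (p : ℕ) (hp : p.Prime) (hodd : Odd p)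
    (hcard : Nat.card G = p ^ 5)
    (hnc : ∃ H : Subgroup G, Nat.card H = p ∧ ¬ H ≤ Subgroup.center G)
    (hΦ : Nat.card (frattini G) = p) :
    ¬ TransisoComplete G p := by
  intro hcomplete
  have : Fact p.Prime := ⟨hp⟩
  have : Finite G := Nat.finite_of_card_ne_zero (hcard ▸ pow_ne_zero _ hp.ne_zero)
  have hG : IsPGroup p G := IsPGroup.of_card hcard
  obtain ⟨H, hH, hHc⟩ := hnc
  have hcomm := hG.commutator_mem_frattini
  have hFc : frattini G ≤ center G := hG.normal_le_center_of_card_prime hΦ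
  have hcore : H.normalCore = ⊥ := by
    by_contra hne
    obtain ⟨g, hg, hg1⟩ := (bot_or_exists_ne_one H.normalCore).resolve_left hne
    have hle : H ≤ H.normalCore :=
      (zpowers_eq_of_card_prime hp hH (H.normalCore_le hg) hg1).symm.trans_le (zpowers_le.mpr hg)
    have : H.Normal := le_antisymm H.normalCore_le hle ▸ H.normalCore_normal
    exact hHc (hG.normal_le_center_of_card_prime hH)
  obtain ⟨S, T, hS, hT, φ, hφ⟩ := hcomplete (frattini G) H hΦ hH (fun h => hHc (h ▸ hFc))
  obtain ⟨K, hHK, hK⟩ := hφ.exists_comm_complement hS hT hcomm hcore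
  obtain ⟨h, hh, hhc⟩ := SetLike.not_le_iff_exists.mp hHc
  have hhH : zpowers h = H :=
    zpowers_eq_of_card_prime hp hH hh (fun e => hhc (e ▸ (center G).one_mem))
  let θ := commutatorPowHom hFc p h hcomm hG.pow_mem_frattini hK
  have hKcard : Nat.card K = p ^ 4 := by
    have := IsComplement'.card_mul_card hHK
    rw [hH, hcard] at this
    exact Nat.eq_of_mul_eq_mul_left hp.pos (this.trans (by ring))
  have hker : p ^ 2 ≤ Nat.card θ.ker := by
    have h₁ := θ.ker.card_mul_index
    rw [index_ker, hKcard] at h₁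
    have h₂ : Nat.card θ.range ≤ p ^ 2 := by
      refine (card_le_card_group θ.range).trans_eq ?_
      rw [Nat.card_prod, hΦ, sq]
    have h₃ : p ^ 2 * p ^ 2 ≤ Nat.card θ.ker * p ^ 2 := by
      calc p ^ 2 * p ^ 2 = Nat.card θ.ker * Nat.card θ.range := by rw [h₁]; ring
        _ ≤ _ := Nat.mul_le_mul_left _ h₂
    exact Nat.le_of_mul_le_mul_right h₃ (pow_pos hp.pos 2)
  obtain ⟨c, hcK, hcker, hcF⟩ : ∃ c, ∃ hc : c ∈ K, (⟨c, hc⟩ : K) ∈ θ.ker ∧ c ∉ frattini G := by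
    by_contra! hcon
    have hle : θ.ker.map K.subtype ≤ frattini G := by
      rintro _ ⟨c, hc, rfl⟩
      exact hcon c c.2 hc
    have := card_le_of_le hle
    rw [card_map_of_injective K.subtype_injective, hΦ] at this
    nlinarith [hp.two_le]
  have hθ : c * h * c⁻¹ * h⁻¹ = 1 ∧ c ^ p = 1 :=
    ⟨congrArg (fun q => (q.1 : G)) hcker, congrArg (fun q => (q.2 : G)) hcker⟩
  have hc1 : c ≠ 1 := fun e => hcF (e ▸ (frattini G).one_mem)
  have hcc : c ∈ center G := by
    refine mem_center_iff.mpr fun g => ?_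
    obtain ⟨⟨⟨a, ha⟩, ⟨k, hk⟩⟩, rfl⟩ := hHK.2 g
    obtain ⟨n, rfl⟩ := mem_zpowers_iff.mp (hhH ▸ ha)
    have hch : Commute c h := by
      have := hθ.1
      rw [mul_assoc, ← mul_inv_rev, mul_inv_eq_one] at this
      exact this
    exact ((hch.zpow_right n).mul_right (hK c hcK k hk)).symm
  have hCcard : Nat.card (zpowers c) = p := by
    rw [Nat.card_zpowers]
    exact orderOf_eq_prime hθ.2 hc1
  have hne : frattini G ≠ zpowers c := fun e => hcF (e ▸ mem_zpowers c)
  have hCc : zpowers c ≤ center G := zpowers_le.mpr hcc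
  obtain ⟨S', T', hS', hT', ψ, hψ⟩ := hcomplete _ _ hΦ hCcard hne
  refine hHc fun x _ => mem_center_iff.mpr fun g => ?_
  obtain ⟨a, ha, s, hs, rfl⟩ := hT'.exists_mul g
  obtain ⟨b, hb, t, ht, rfl⟩ := hT'.exists_mul x
  have hst : s * t = t * s := by
    obtain ⟨u, hu, e⟩ := hψ.comm hS' hcomm hs ht
    have huF : u ∈ frattini G := by
      have : u = s * t * s⁻¹ * t⁻¹ := by rw [e]; group
      exact this ▸ hcomm s t
    by_cases hu1 : u = 1
    · rw [e, hu1, one_mul]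
    · exact absurd (eq_of_card_prime_of_mem hp hΦ hCcard huF hu hu1) hne
  have ha' (y : G) : Commute a y := (mem_center_iff.mp (hCc ha) y).symm
  have hb' (y : G) : Commute b y := (mem_center_iff.mp (hCc hb) y).symm
  exact (ha' _).mul_left ((hb' s).symm.mul_right hst)
end

section
/- Let p be an odd prime and G a group of order p⁵ having a subgroup of order p not contained in the center Z(G), whose Frattini subgroup Φ(G) has order p³. Then the transiso graph Γ_p(G) is not complete, i.e., there exist two distinct subgroups of G of order p that admit no pair of isomorphic NRTs. -/
open Subgroup

/-- A normal subgroup of order `p` in a finite `p`-group is central. -/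
lemma IsPGroup.le_center_of_card_eq_prime {G : Type*} [Group G] [Finite G] {p : ℕ}
    [Fact p.Prime] (hG : IsPGroup p G) (K : Subgroup G) [K.Normal] (hK : Nat.card K = p) :
    K ≤ center G := by
  have h1 : (1 : K) ∈ MulAction.fixedPoints (ConjAct G) K := fun g => smul_one g
  obtain ⟨b, hb, hb1⟩ := IsPGroup.exists_fixed_point_of_prime_dvd_card_of_fixed_point
    (G := ConjAct G) (hG.of_equiv ConjAct.toConjAct) K (by rw [hK]) h1
  have hbc : (b : G) ∈ center G := by
    rw [mem_center_iff]
    intro g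
    have := congrArg Subtype.val (hb (ConjAct.toConjAct g))
    rw [ConjAct.Subgroup.val_conj_smul, ConjAct.toConjAct_smul] at this
    exact mul_inv_eq_iff_eq_mul.mp this
  intro x hx
  obtain ⟨n, hn⟩ := mem_zpowers_iff.mp
    (mem_zpowers_of_prime_card hK (g := b) (g' := ⟨x, hx⟩) hb1.symm)
  rw [show x = (b : G) ^ n by rw [← Subgroup.coe_zpow, hn]]
  exact zpow_mem hbc n

/-- In a finite `p`-group, if a subgroup `K` of order `p` is not central, the conjugates of a
nontrivial element do not all lie in `K`. -/
lemma IsPGroup.eq_one_of_conj_mem {G : Type*} [Group G] [Finite G] {p : ℕ}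
    [Fact p.Prime] (hG : IsPGroup p G) (K : Subgroup G) (hK : Nat.card K = p)
    (hnc : ¬ K ≤ center G) {h : G} (hh : ∀ g : G, g * h * g⁻¹ ∈ K) : h = 1 := by
  by_contra h1
  refine hnc ?_
  have hhK : h ∈ K := by simpa using hh 1
  have hgen : ∀ x ∈ K, ∃ n : ℤ, h ^ n = x := fun x hx => by
    obtain ⟨n, hn⟩ := mem_zpowers_iff.mp
      (mem_zpowers_of_prime_card hK (g := ⟨h, hhK⟩) (g' := ⟨x, hx⟩)
        (fun e => h1 (congrArg Subtype.val e)))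
    exact ⟨n, congrArg Subtype.val hn⟩
  have : K.Normal := ⟨fun x hx g => by
    obtain ⟨n, rfl⟩ := hgen x hx
    rw [← conj_zpow]
    exact zpow_mem (hh g) n⟩
  exact hG.le_center_of_card_eq_prime K hK

/-- If `K` is a non-central subgroup of order `p` adjacent to a normal subgroup `H`, then `K` has
a complement isomorphic to `G ⧸ H`. -/
lemma TransisoAdj.exists_complement {G : Type*} [Group G] [Finite G] {p : ℕ}
    [Fact p.Prime] (hG : IsPGroup p G) (K H : Subgroup G) [H.Normal] (hK : Nat.card K = p)
    (hnc : ¬ K ≤ center G) (hadj : TransisoAdj K H) :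
    ∃ M : Subgroup G, IsComplement' K M ∧ Nonempty (M ≃* G ⧸ H) := by
  obtain ⟨S, T, ⟨hS1, hS⟩, ⟨-, hT⟩, φ, hφ, hmul⟩ := hadj
  let ψ : G → G ⧸ H := fun x => (φ x : G ⧸ H)
  have hψ : ∀ x ∈ S, ∀ y ∈ S, ∀ z ∈ S, (∃ h ∈ K, x * y = h * z) → ψ x * ψ y = ψ z := by
    intro x hx y hy z hz hxyz
    obtain ⟨h, hh, e⟩ := hmul x hx y hy z hz hxyz
    change ((φ x * φ y : G) : G ⧸ H) = _
    rw [e, QuotientGroup.mk_mul, (QuotientGroup.eq_one_iff h).mpr hh, one_mul]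
  have hψinj : Set.InjOn ψ S := by
    intro x hx y hy e
    apply hφ.injOn hx hy
    refine (hT (φ x)).unique ⟨hφ.mapsTo hx, 1, H.one_mem, by simp⟩
      ⟨hφ.mapsTo hy, φ x * (φ y)⁻¹, ?_, by simp⟩
    rw [← QuotientGroup.eq_one_iff, QuotientGroup.mk_mul, QuotientGroup.mk_inv]
    exact mul_inv_eq_one.mpr e
  have hψsurj : ∀ q : G ⧸ H, ∃ x ∈ S, ψ x = q := by
    intro q
    obtain ⟨g, rfl⟩ := QuotientGroup.mk_surjective q
    obtain ⟨t, ⟨ht, h, hh, e⟩, -⟩ := hT g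
    obtain ⟨x, hx, rfl⟩ := hφ.surjOn ht
    refine ⟨x, hx, ?_⟩
    rw [e, QuotientGroup.mk_mul, (QuotientGroup.eq_one_iff h).mpr hh, one_mul]
  have hclosed : ∀ x ∈ S, ∀ y ∈ S, x * y ∈ S := by
    intro x hx y hy
    obtain ⟨z, ⟨hz, h, hh, e⟩, -⟩ := hS (x * y)
    suffices h = 1 by rw [e, this, one_mul]; exact hz
    apply hG.eq_one_of_conj_mem K hK hnc
    have key : ∀ s ∈ S, s * h * s⁻¹ ∈ K := by
      intro s hs
      obtain ⟨a, ⟨ha, k₁, hk₁, e₁⟩, -⟩ := hS (s * x)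
      obtain ⟨b, ⟨hb, k₂, hk₂, e₂⟩, -⟩ := hS (a * y)
      obtain ⟨c, ⟨hc, k₃, hk₃, e₃⟩, -⟩ := hS (s * z)
      have hbc : b = c := by
        apply hψinj hb hc
        rw [← hψ a ha y hy b hb ⟨k₂, hk₂, e₂⟩, ← hψ s hs x hx a ha ⟨k₁, hk₁, e₁⟩,
          ← hψ s hs z hz c hc ⟨k₃, hk₃, e₃⟩, ← hψ x hx y hy z hz ⟨h, hh, e⟩, mul_assoc]
      have h1 : s * (x * y) = k₁ * k₂ * b := by rw [← mul_assoc, e₁, mul_assoc, e₂, mul_assoc]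
      have h2 : s * h * s⁻¹ = k₁ * k₂ * k₃⁻¹ := by
        have : s * h * s⁻¹ * (s * z) = s * (x * y) := by rw [e]; group
        rw [e₃, h1, hbc] at this
        rw [← mul_left_inj (k₃ * c), this]
        group
      rw [h2]
      exact mul_mem (mul_mem hk₁ hk₂) (inv_mem hk₃)
    intro g
    obtain ⟨s, ⟨hs, k, hk, rfl⟩, -⟩ := hS g
    have : k * s * h * (k * s)⁻¹ = k * (s * h * s⁻¹) * k⁻¹ := by group
    rw [this]
    exact mul_mem (mul_mem hk (key s hs)) (inv_mem hk)
  have hpow : ∀ x ∈ S, ∀ n : ℕ, x ^ n ∈ S := by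
    intro x hx n
    induction n with
    | zero => simpa using hS1
    | succ n ih => rw [pow_succ]; exact hclosed _ ih _ hx
  let M : Subgroup G :=
    { carrier := S
      mul_mem' := fun {x y} hx hy => hclosed x hx y hy
      one_mem' := hS1
      inv_mem' := fun {x} hx => by
        obtain ⟨n, hn⟩ := mem_powers_iff_mem_zpowers.mpr (inv_mem (mem_zpowers x))
        exact hn ▸ hpow x hx n }
  refine ⟨M, ?_, ⟨MulEquiv.ofBijective (MonoidHom.mk' (fun x : M => ψ x) ?_) ⟨?_, ?_⟩⟩⟩
  · rw [isComplement'_def, isComplement_iff_existsUnique_mul_inv_mem]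
    intro g
    obtain ⟨s, ⟨hs, k, hk, e⟩, hu⟩ := hS g
    refine ⟨⟨s, hs⟩, by simpa [e] using hk, fun t ht => ?_⟩
    exact Subtype.ext (hu t ⟨t.2, g * (t : G)⁻¹, ht, by simp⟩)
  · intro a b
    exact (hψ a a.2 b b.2 _ (a * b).2 ⟨1, K.one_mem, by simp⟩).symm
  · exact fun a b e => Subtype.ext (hψinj a.2 b.2 e)
  · intro q
    obtain ⟨x, hx, e⟩ := hψsurj q
    exact ⟨⟨x, hx⟩, e⟩

/-- The power formula in class two: if `k b k⁻¹ = t b` and `t` commutes with `b` and `k`, then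
`(b k) ^ n = b ^ n t ^ (n choose 2) k ^ n`. -/
lemma mul_pow_of_mul_eq {G : Type*} [Group G] {b k t : G} (h : k * b = t * b * k)
    (hb : Commute t b) (hk : Commute t k) (n : ℕ) :
    (b * k) ^ n = b ^ n * t ^ n.choose 2 * k ^ n := by
  have hkn : ∀ n : ℕ, k ^ n * b = t ^ n * b * k ^ n := by
    intro n
    induction n with
    | zero => simp
    | succ n ih =>
      calc k ^ (n + 1) * b = k ^ n * (k * b) := by rw [pow_succ, mul_assoc]
        _ = (k ^ n * t) * (b * k) := by rw [h]; group
        _ = t * (k ^ n * b) * k := by rw [← (hk.pow_right n).eq]; group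
        _ = t ^ (n + 1) * b * k ^ (n + 1) := by rw [ih]; group
  induction n with
  | zero => simp
  | succ n ih =>
    have e : (n + 1).choose 2 = n.choose 2 + n := by
      rw [Nat.choose_succ_succ' n 1, Nat.choose_one_right, add_comm]
    calc (b * k) ^ (n + 1) = b ^ n * t ^ n.choose 2 * (k ^ n * b) * k := by
          rw [pow_succ, ih]; group
      _ = b ^ n * (t ^ (n.choose 2 + n) * b) * k ^ (n + 1) := by
          rw [hkn, pow_add, pow_succ k]; simp only [mul_assoc]
      _ = b ^ (n + 1) * t ^ (n + 1).choose 2 * k ^ (n + 1) := by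
          rw [(hb.pow_left _).eq, e, pow_succ b]; simp only [mul_assoc]

lemma mul_pow_prime_of_mul_eq {G : Type*} [Group G] {p : ℕ} (hp : p.Prime) (hodd : Odd p)
    {b k t : G} (h : k * b = t * b * k) (hb : Commute t b) (hk : Commute t k) (ht : t ^ p = 1) :
    (b * k) ^ p = b ^ p * k ^ p := by
  have h2 : 2 < p := lt_of_le_of_ne hp.two_le fun e => by
    rw [← e] at hodd
    exact absurd hodd (by decide)
  obtain ⟨r, hr⟩ := hp.dvd_choose_self two_ne_zero h2
  rw [mul_pow_of_mul_eq h hb hk, hr, pow_mul, ht, one_pow, mul_one]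

/-- For odd `p`, a group of order `p ^ 3` whose elements of order `p` are all central is
abelian. -/
lemma commute_of_card_eq_prime_cube {Q : Type*} [Group Q] {p : ℕ} (hp : p.Prime)
    (hodd : Odd p) (hQ : Nat.card Q = p ^ 3) (hc : ∀ x : Q, x ^ p = 1 → x ∈ center Q)
    (x y : Q) : Commute x y := by
  have : Fact p.Prime := ⟨hp⟩
  have : Finite Q := Nat.finite_of_card_ne_zero (by rw [hQ]; exact pow_ne_zero _ hp.ne_zero)
  by_contra hxy
  have hncyc : ¬ IsCyclic (Q ⧸ center Q) := fun hcyc =>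
    hxy ((isMulCommutative_of_isCyclic_quotient_center_self Q).is_comm.comm x y)
  have hmul := (center Q).card_mul_index
  rw [hQ, Subgroup.index] at hmul
  obtain ⟨i, hi0, hi⟩ := IsPGroup.card_center_eq_prime_pow hQ three_pos
  obtain ⟨j, hj3, hj⟩ := (Nat.dvd_prime_pow hp).mp (Dvd.intro_left _ hmul)
  rw [hi, hj, ← pow_add] at hmul
  have hij : i + j = 3 := Nat.pow_right_injective hp.two_le hmul
  have hj2 : j = 2 := by
    have h0 : j ≠ 0 := by
      rintro rfl
      have := (Nat.card_eq_one_iff_unique.mp (hj.trans (pow_zero p))).1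
      exact hncyc inferInstance
    have h1 : j ≠ 1 := by
      rintro rfl
      exact hncyc (isCyclic_of_prime_card (hj.trans (pow_one p)))
    lia
  have hZ : Nat.card (center Q) = p := by rw [hi, show i = 1 by lia, pow_one]
  rw [hj2] at hj
  have hcomm := (IsPGroup.isMulCommutative_of_card_eq_prime_sq hj).is_comm.comm
  have hpow : ∀ g : Q, g ^ p ∈ center Q := by
    intro g
    rw [← QuotientGroup.eq_one_iff, QuotientGroup.mk_pow, ← orderOf_dvd_iff_pow_eq_one]
    obtain ⟨r, hr2, hr⟩ := (Nat.dvd_prime_pow hp).mp (hj ▸ orderOf_dvd_natCard (g : Q ⧸ center Q))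
    have : r ≠ 2 := by
      rintro rfl
      exact hncyc (isCyclic_of_orderOf_eq_card _ (hr.trans hj.symm))
    rw [hr]
    exact (pow_dvd_pow p (show r ≤ 1 by lia)).trans (pow_one p).dvd
  have hx1 : x ^ p ≠ 1 := fun e => hxy (mem_center_iff.mp (hc x e) y).symm
  obtain ⟨n, hn⟩ := mem_zpowers_iff.mp (mem_zpowers_of_prime_card hZ
    (g := ⟨x ^ p, hpow x⟩) (g' := ⟨y ^ p, hpow y⟩) (fun e => hx1 (congrArg Subtype.val e)))
  replace hn : (x ^ p) ^ n = y ^ p := congrArg Subtype.val hn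
  set w := x ^ (-n) with hw
  set t := y * w * y⁻¹ * w⁻¹ with ht
  have htc : t ∈ center Q := by
    rw [← QuotientGroup.eq_one_iff]
    simp only [ht, QuotientGroup.mk_mul, QuotientGroup.mk_inv]
    rw [hcomm (y : Q ⧸ center Q) w]
    group
  have htp : t ^ p = 1 := by
    have := pow_card_eq_one' (x := (⟨t, htc⟩ : center Q))
    rw [hZ] at this
    exact congrArg Subtype.val this
  have hwp : (w * y) ^ p = 1 := by
    rw [mul_pow_prime_of_mul_eq hp hodd (t := t) (by rw [ht]; group)
      (mem_center_iff.mp htc w).symm (mem_center_iff.mp htc y).symm htp, ← hn, hw,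
      ← zpow_natCast (x ^ (-n)), ← zpow_natCast x, ← zpow_mul, ← zpow_mul, ← zpow_add]
    rw [show -n * (p : ℤ) + p * n = 0 by ring, zpow_zero]
  have hwy := mem_center_iff.mp (hc _ hwp) x
  apply hxy
  have hxw : Commute x w := (Commute.refl x).zpow_right _
  have : Commute x (w⁻¹ * (w * y)) := hxw.inv_right.mul_right hwy
  simpa using this

/-- Let `A` be an abelian normal subgroup on which `k` acts. Then
`a ↦ (a k) ^ q k ^ (-q)` is multiplicative on `A`. -/
lemma pow_mul_pow_of_comm {G : Type*} [Group G] (A : Subgroup G) [A.Normal]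
    (hA : ∀ x ∈ A, ∀ y ∈ A, Commute x y) {d k : G} (hd : d ∈ A) (n q : ℕ) :
    (d * k) ^ q * (k ^ q)⁻¹ ∈ A ∧
      (d ^ n * k) ^ q * (k ^ q)⁻¹ = ((d * k) ^ q * (k ^ q)⁻¹) ^ n := by
  induction q with
  | zero => simp
  | succ q ih =>
    obtain ⟨h1, h2⟩ := ih
    have hstep : ∀ a : G, (a * k) ^ (q + 1) * (k ^ (q + 1))⁻¹ =
        ((a * k) ^ q * (k ^ q)⁻¹) * (k ^ q * a * (k ^ q)⁻¹) := by
      intro a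
      rw [pow_succ, pow_succ]
      group
    have hdA : k ^ q * d * (k ^ q)⁻¹ ∈ A := Normal.conj_mem inferInstance d hd _
    refine ⟨hstep d ▸ mul_mem h1 hdA, ?_⟩
    rw [hstep, hstep, h2, (hA _ h1 _ hdA).mul_pow, conj_pow]

/-- Let `A` be an abelian normal subgroup whose elements of order `p` are central, `p` odd. If
`d ∈ A` has order dividing `p ^ 3` and both `k` and `d k` have order `p`, then `d ^ p = 1`. -/
lemma pow_prime_eq_one_of_mul_pow {G : Type*} [Group G] {p : ℕ} (hp : p.Prime) (hodd : Odd p)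
    (A : Subgroup G) [A.Normal] (hA : ∀ x ∈ A, ∀ y ∈ A, Commute x y)
    (hc : ∀ x ∈ A, x ^ p = 1 → x ∈ center G) {d k : G} (hd : d ∈ A) (hd3 : d ^ p ^ 3 = 1)
    (hk : k ^ p = 1) (hdk : (d * k) ^ p = 1) : d ^ p = 1 := by
  have key : ∀ b ∈ A, b ^ p ^ 2 = 1 → (b * k) ^ p = 1 → b ^ p = 1 := by
    intro b hb hb2 hbk
    have hcb : k * b * k⁻¹ ∈ A := Normal.conj_mem inferInstance b hb k
    have hbp : b ^ p ∈ center G := hc _ (pow_mem hb p) (by rw [← pow_mul, ← sq, hb2])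
    have htA : k * b * k⁻¹ * b⁻¹ ∈ A := mul_mem hcb (inv_mem hb)
    have htp : (k * b * k⁻¹ * b⁻¹) ^ p = 1 := by
      rw [(hA _ hcb _ (inv_mem hb)).mul_pow, conj_pow, mem_center_iff.mp hbp k]
      group
    have htc := hc _ htA htp
    rw [mul_pow_prime_of_mul_eq hp hodd (t := k * b * k⁻¹ * b⁻¹) (by group)
      (mem_center_iff.mp htc b).symm (mem_center_iff.mp htc k).symm htp, hk, mul_one] at hbk
    exact hbk
  have hpow : ∀ n : ℕ, (d ^ n * k) ^ p = 1 := by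
    intro n
    have := (pow_mul_pow_of_comm A hA (k := k) hd n p).2
    simpa [hk, hdk] using this
  refine key d hd ?_ hdk
  rw [sq, pow_mul]
  refine key _ (pow_mem hd p) ?_ (hpow p)
  rw [← pow_mul, ← pow_succ', hd3]

lemma mem_center_of_closure_pair_eq_top {G : Type*} [Group G] {k m z : G}
    (h : closure {k, m} = ⊤) (hk : Commute k z) (hm : Commute m z) : z ∈ center G := by
  have hle : closure {k, m} ≤ centralizer {z} := by
    rw [closure_le]
    rintro x (rfl | rfl)
    · exact mem_centralizer_singleton_iff.mpr hk.eq
    · exact mem_centralizer_singleton_iff.mpr hm.eq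
  rw [h] at hle
  exact mem_center_iff.mpr fun g => mem_centralizer_singleton_iff.mp (hle (mem_top g))

lemma isCoatom_of_index_prime {G : Type*} [Group G] {M : Subgroup G} (h : M.index.Prime) :
    IsCoatom M := by
  refine ⟨fun e => h.ne_one (index_eq_one.mpr e), fun N hN => ?_⟩
  rcases (Nat.dvd_prime h).mp (index_dvd_of_le hN.le) with h1 | h1
  · exact index_eq_one.mp h1
  · have := relIndex_mul_index hN.le
    rw [h1] at this
    have h2 := Nat.eq_of_mul_eq_mul_right h.pos (this.trans (one_mul _).symm)
    exact absurd (relIndex_eq_one.mp h2) hN.not_ge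

/-- A complement of a subgroup of prime order contains the Frattini subgroup. -/
lemma frattini_le_of_isComplement' {G : Type*} [Group G] {p : ℕ} (hp : p.Prime)
    {K M : Subgroup G} (hK : Nat.card K = p) (h : IsComplement' K M) : frattini G ≤ M :=
  frattini_le_coatom (isCoatom_of_index_prime (by rwa [h.index_eq_card, hK]))

lemma normal_zpowers_of_mem_center {G : Type*} [Group G] {c : G} (hc : c ∈ center G) :
    (zpowers c).Normal :=
  ⟨fun x hx g => by
    rw [mem_center_iff.mp (zpowers_le.mpr hc hx) g, mul_inv_cancel_right]
    exact hx⟩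

/-- The structure of a complement `M` of a subgroup of order `p`: it is generated by some `m` and
the central commutator of `k` and `m`, which has order dividing `p`. -/
lemma exists_generator_of_isComplement' {G : Type*} [Group G] {p : ℕ} (hp : p.Prime)
    (hodd : Odd p) (hcard : Nat.card G = p ^ 5) (hΦ : Nat.card (frattini G) = p ^ 3)
    (hΦc : ∀ x ∈ frattini G, x ^ p = 1 → x ∈ center G) {k : G}
    (hk : Nat.card (zpowers k) = p) {M : Subgroup G} (hM : IsComplement' (zpowers k) M) :
    ∃ m ∈ M, closure {k, m} = ⊤ ∧ k * m * k⁻¹ * m⁻¹ ∈ center G ∧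
      (k * m * k⁻¹ * m⁻¹) ^ p = 1 ∧ M ≤ zpowers m ⊔ zpowers (k * m * k⁻¹ * m⁻¹) := by
  have : Fact p.Prime := ⟨hp⟩
  have : Finite G := Nat.finite_of_card_ne_zero (by rw [hcard]; exact pow_ne_zero _ hp.ne_zero)
  have hΦM : frattini G ≤ M := frattini_le_of_isComplement' hp hk hM
  have hMcard : Nat.card M = p ^ 4 := by
    have := hM.card_mul_card
    rw [hk, hcard, pow_succ' p 4] at this
    exact Nat.eq_of_mul_eq_mul_left hp.pos this
  have hΦcomm : ∀ x ∈ frattini G, ∀ y ∈ frattini G, Commute x y := by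
    intro x hx y hy
    have := commute_of_card_eq_prime_cube hp hodd hΦ (fun a ha => by
      refine mem_center_iff.mpr fun b => Subtype.ext ?_
      exact mem_center_iff.mp (hΦc a a.2 (congrArg Subtype.val ha)) b) ⟨x, hx⟩ ⟨y, hy⟩
    exact congrArg Subtype.val this.eq
  obtain ⟨m, hm, hmΦ⟩ : ∃ m ∈ M, m ∉ frattini G := by
    by_contra! hle
    have := Subgroup.card_le_of_le (show M ≤ frattini G from hle)
    rw [hMcard, hΦ] at this
    exact absurd this (Nat.pow_lt_pow_right hp.one_lt (by lia)).not_ge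
  have hMsup : M ≤ frattini G ⊔ zpowers m := by
    have hle : frattini G ⊔ zpowers m ≤ M := sup_le hΦM (zpowers_le.mpr hm)
    refine (Subgroup.eq_of_le_of_card_ge hle ?_).ge
    rw [hMcard]
    obtain ⟨r, -, hr⟩ := (Nat.dvd_prime_pow hp).mp
      (hcard ▸ card_subgroup_dvd_card (frattini G ⊔ zpowers m))
    rw [hr]
    refine Nat.pow_le_pow_right hp.pos ?_
    by_contra! hlt
    refine hmΦ ((Subgroup.eq_of_le_of_card_ge (le_sup_left : frattini G ≤ _ ⊔ zpowers m) ?_).ge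
      (mem_sup_right (mem_zpowers m)))
    rw [hr, hΦ]
    exact Nat.pow_le_pow_right hp.pos (by lia)
  have hgen : closure {k, m} = ⊤ := by
    have hkc : zpowers k ≤ closure {k, m} := zpowers_le.mpr (subset_closure (by simp))
    have hmc : zpowers m ≤ closure {k, m} := zpowers_le.mpr (subset_closure (by simp))
    refine frattini_nongenerating (top_le_iff.mp ?_)
    rw [← hM.sup_eq_top]
    exact sup_le (hkc.trans le_sup_left)
      (hMsup.trans (sup_le le_sup_right (hmc.trans le_sup_left)))
  set c := k * m * k⁻¹ * m⁻¹ with hc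
  have hcΦ : c ∈ frattini G := by
    have hq : Nat.card (G ⧸ frattini G) = p ^ 2 := by
      have := (frattini G).card_mul_index
      rw [hΦ, hcard, Subgroup.index, pow_add p 3 2] at this
      exact Nat.eq_of_mul_eq_mul_left (pow_pos hp.pos 3) this
    have hcomm := (IsPGroup.isMulCommutative_of_card_eq_prime_sq hq).is_comm.comm
    rw [← QuotientGroup.eq_one_iff]
    simp only [hc, QuotientGroup.mk_mul, QuotientGroup.mk_inv]
    rw [hcomm (k : G ⧸ frattini G) m]
    group
  have hkp : k ^ p = 1 := by
    rw [← hk, Nat.card_zpowers]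
    exact pow_orderOf_eq_one k
  have hcp : c ^ p = 1 := by
    have hinv : c⁻¹ ^ p = 1 := by
      refine pow_prime_eq_one_of_mul_pow hp hodd (frattini G) hΦcomm hΦc (k := k)
        (inv_mem hcΦ) ?_ hkp ?_
      · have := pow_card_eq_one' (x := (⟨c⁻¹, inv_mem hcΦ⟩ : frattini G))
        rw [hΦ] at this
        exact congrArg Subtype.val this
      · rw [show c⁻¹ * k = m * k * m⁻¹ by rw [hc]; group, conj_pow, hkp]
        group
    simpa using hinv
  have hcc : c ∈ center G := hΦc c hcΦ hcp
  refine ⟨m, hm, hgen, hcc, hcp, ?_⟩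
  have hcn := normal_zpowers_of_mem_center hcc
  set L := zpowers m ⊔ zpowers c with hL
  have hmL : m ∈ L := mem_sup_left (mem_zpowers m)
  have hcL : c ∈ L := mem_sup_right (mem_zpowers c)
  have hLM : L ≤ M := sup_le (zpowers_le.mpr hm) (zpowers_le.mpr (hΦM hcΦ))
  have hconj : ∀ x ∈ L, k * x * k⁻¹ ∈ L := by
    have hle : L ≤ L.comap (MulAut.conj k).toMonoidHom := by
      refine sup_le (zpowers_le.mpr ?_) (zpowers_le.mpr ?_)
      · change k * m * k⁻¹ ∈ L
        rw [show k * m * k⁻¹ = c * m by rw [hc]; group]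
        exact mul_mem hcL hmL
      · change k * c * k⁻¹ ∈ L
        rw [mem_center_iff.mp hcc k, mul_inv_cancel_right]
        exact hcL
    exact hle
  have hLn : L.Normal := by
    rw [← normalizer_eq_top_iff, ← top_le_iff, ← hgen, closure_le]
    rintro x (rfl | rfl)
    · exact mem_normalizer_fintype hconj
    · exact le_normalizer hmL
  have htop : zpowers k ⊔ L = ⊤ := by
    rw [← top_le_iff, ← hgen, closure_le]
    rintro x (rfl | rfl)
    · exact mem_sup_left (mem_zpowers _)
    · exact mem_sup_right hmL
  intro x hx
  obtain ⟨a, ha, l, hl, rfl⟩ := mem_sup_of_normal_right.mp (htop ▸ mem_top x)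
  have haM : a ∈ M := by simpa using mul_mem hx (inv_mem (hLM hl))
  rw [disjoint_def.mp hM.disjoint ha haM, one_mul]
  exact hl

theorem stmt_18 {G : Type*} [Group G] (p : ℕ) (hp : p.Prime) (hodd : Odd p)
    (hcard : Nat.card G = p ^ 5)
    (hnc : ∃ H : Subgroup G, Nat.card H = p ∧ ¬ H ≤ Subgroup.center G)
    (hΦ : Nat.card (frattini G) = p ^ 3) :
    ¬ TransisoComplete G p := by
  intro hcomp
  have : Fact p.Prime := ⟨hp⟩
  have : Finite G := Nat.finite_of_card_ne_zero (by rw [hcard]; exact pow_ne_zero _ hp.ne_zero)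
  have hG : IsPGroup p G := IsPGroup.of_card hcard
  have hadj : ∀ K : Subgroup G, Nat.card K = p → ¬ K ≤ center G → ∀ z ∈ center G,
      orderOf z = p → ∃ (_ : (zpowers z).Normal) (M : Subgroup G),
        IsComplement' K M ∧ Nonempty (M ≃* G ⧸ zpowers z) := by
    intro K hK hKc z hz hzp
    have := normal_zpowers_of_mem_center hz
    refine ⟨this, TransisoAdj.exists_complement hG K (zpowers z) hK hKc
      (hcomp _ _ hK (by rw [Nat.card_zpowers, hzp]) ?_)⟩
    rintro rfl
    exact hKc (zpowers_le.mpr hz)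
  obtain ⟨z₀, hz₀, hz₀p⟩ : ∃ z ∈ center G, orderOf z = p := by
    obtain ⟨i, hi0, hi⟩ := IsPGroup.card_center_eq_prime_pow hcard (by lia)
    obtain ⟨z, hz⟩ := exists_prime_orderOf_dvd_card' (G := center G) p
      (hi ▸ dvd_pow_self p hi0.ne')
    exact ⟨z, z.2, by rw [← hz, Subgroup.orderOf_coe]⟩
  have hΦc : ∀ x ∈ frattini G, x ^ p = 1 → x ∈ center G := by
    intro x hx hxp
    by_contra hxc
    have hxo : Nat.card (zpowers x) = p := by
      rw [Nat.card_zpowers]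
      exact orderOf_eq_prime hxp (fun e => hxc (e ▸ one_mem _))
    obtain ⟨-, M, hM, -⟩ := hadj _ hxo (fun h => hxc (h (mem_zpowers x))) z₀ hz₀ hz₀p
    have := disjoint_def.mp hM.disjoint (mem_zpowers x)
      (frattini_le_of_isComplement' hp hxo hM hx)
    exact hxc (this ▸ one_mem _)
  obtain ⟨K, hK, hKc⟩ := hnc
  obtain ⟨k, rfl⟩ := Subgroup.isCyclic_iff_exists_zpowers_eq_top K |>.mp (isCyclic_of_prime_card hK)
  have hkc : k ∉ center G := fun h => hKc (zpowers_le.mpr h)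
  obtain ⟨_, M, hM, ⟨e⟩⟩ := hadj _ hK hKc z₀ hz₀ hz₀p
  obtain ⟨m, hm, hgen, hcc, hcp, hMle⟩ :=
    exists_generator_of_isComplement' hp hodd hcard hΦ hΦc hK hM
  have hMcard : Nat.card M = p ^ 4 := by
    have := hM.card_mul_card
    rw [hK, hcard, pow_succ' p 4] at this
    exact Nat.eq_of_mul_eq_mul_left hp.pos this
  have hmp3 : m ^ p ^ 3 = 1 := by
    rw [← orderOf_dvd_iff_pow_eq_one]
    obtain ⟨r, hr4, hr⟩ := (Nat.dvd_prime_pow hp).mp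
      (hMcard ▸ orderOf_dvd_natCard (⟨m, hm⟩ : M))
    rw [Subgroup.orderOf_mk] at hr
    rw [hr]
    refine pow_dvd_pow p ?_
    by_contra! hlt
    have hr4' : r = 4 := by lia
    subst hr4'
    have : IsCyclic M := isCyclic_of_orderOf_eq_card ⟨m, hm⟩
      (by rw [Subgroup.orderOf_mk, hr, hMcard])
    have : IsCyclic (G ⧸ zpowers z₀) := e.isCyclic.mp this
    have hcomm := (QuotientGroup.mk' (zpowers z₀)).isMulCommutative_of_isCyclic_of_ker_le_center
      (by rw [QuotientGroup.ker_mk']; exact zpowers_le.mpr hz₀)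
    exact hkc (mem_center_iff.mpr fun g => hcomm.is_comm.comm g k)
  set c := k * m * k⁻¹ * m⁻¹ with hc
  have hcn := normal_zpowers_of_mem_center hcc
  have hmo : orderOf (m ^ p ^ 2) = p := by
    refine orderOf_eq_prime (by rw [← pow_mul, ← pow_succ, hmp3]) fun h1 => ?_
    have h2 : Nat.card M ≤ Nat.card (zpowers m) * Nat.card (zpowers c) := by
      refine (Subgroup.card_le_of_le hMle).trans ?_
      have := Set.natCard_mul_le (s := (zpowers m : Set G)) (t := (zpowers c : Set G))
      rwa [← mul_normal] at this
    rw [hMcard, Nat.card_zpowers, Nat.card_zpowers] at h2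
    have h3 := Nat.mul_le_mul (orderOf_le_of_pow_eq_one (pow_pos hp.pos 2) h1)
      (orderOf_le_of_pow_eq_one hp.pos hcp)
    rw [← pow_succ] at h3
    exact absurd (h2.trans h3) (Nat.pow_lt_pow_right hp.one_lt (by lia)).not_ge
  have hzc : m ^ p ^ 2 ∈ center G := by
    refine mem_center_of_closure_pair_eq_top hgen ?_ ((Commute.refl m).pow_right _)
    refine mul_inv_eq_iff_eq_mul.mp ?_
    have hcm : Commute c m := (mem_center_iff.mp hcc m).symm
    rw [← conj_pow, show k * m * k⁻¹ = c * m by rw [hc]; group, hcm.mul_pow, sq, pow_mul, hcp,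
      one_pow, one_mul]
  obtain ⟨_, N, hN, ⟨f⟩⟩ := hadj _ hK hKc _ hzc hmo
  obtain ⟨n, -, -, hdc, -, hNle⟩ :=
    exists_generator_of_isComplement' hp hodd hcard hΦ hΦc hK hN
  set d := k * n * k⁻¹ * n⁻¹ with hd
  have hdn := normal_zpowers_of_mem_center hdc
  have hNcomm : ∀ x y : N, x * y = y * x := by
    have hform : ∀ x : N, ∃ i : ℤ, ∃ w ∈ center G, (x : G) = n ^ i * w := by
      intro x
      obtain ⟨a, ⟨i, rfl⟩, w, hw, e⟩ := mem_sup_of_normal_right.mp (hNle x.2)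
      exact ⟨i, w, zpowers_le.mpr hdc hw, e.symm⟩
    intro x y
    obtain ⟨i, w, hw, hx⟩ := hform x
    obtain ⟨j, v, hv, hy⟩ := hform y
    apply Subtype.ext
    have h1 : Commute (n ^ i * w) (n ^ j * v) := by
      have hcw : ∀ g, Commute w g := fun g => (mem_center_iff.mp hw g).symm
      have hcv : ∀ g, Commute g v := fun g => mem_center_iff.mp hv g
      exact (((Commute.refl n).zpow_zpow i j).mul_left (hcw _)).mul_right (hcv _)
    rw [Subgroup.coe_mul, Subgroup.coe_mul, hx, hy, h1.eq]
  have hcz : c ∈ zpowers (m ^ p ^ 2) := by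
    have hcomm : ∀ a b : G ⧸ zpowers (m ^ p ^ 2), a * b = b * a := fun a b => by
      have := congrArg f (hNcomm (f.symm a) (f.symm b))
      simpa using this
    rw [← QuotientGroup.eq_one_iff]
    simp only [hc, QuotientGroup.mk_mul, QuotientGroup.mk_inv]
    rw [hcomm (k : G ⧸ zpowers (m ^ p ^ 2)) m]
    group
  have hcm : zpowers c ≤ zpowers m :=
    zpowers_le.mpr (zpowers_le.mpr (pow_mem (mem_zpowers m) _) hcz)
  have h1 := Subgroup.card_le_of_le (hMle.trans (sup_le le_rfl hcm))
  rw [hMcard, Nat.card_zpowers] at h1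
  have h2 := orderOf_le_of_pow_eq_one (pow_pos hp.pos 3) hmp3
  exact absurd (h1.trans h2) (Nat.pow_lt_pow_right hp.one_lt (by lia)).not_ge
end
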